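/- arXiv:1907.07112 — 2 statements merged into one kernel-verified Lean document; each statement's English description precedes it below -/
import Mathlib

section
/- Let Ω be a nonempty bounded convex open subset of ℝ^n (n ≥ 1). Then among all ellipsoids containing Ω there is a unique one, E, of minimal Lebesgue volume (the minimal ellipsoid of Ω). Moreover, if c denotes the center of E, then the dilation c + (1/n)(E − c) of E by factor 1/n about its center is contained in the closure of Ω. -/
open Set MeasureTheory

/-- An ellipsoid in `ℝ^n` with given center: the image of the closed unit ball under an
invertible affine map sending `0` to the center. -/
def IsEllipsoidWithCenter {n : ℕ} (E : Set (EuclideanSpace ℝ (Fin n)))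
    (c : EuclideanSpace ℝ (Fin n)) : Prop :=
  ∃ T : EuclideanSpace ℝ (Fin n) ≃ᵃ[ℝ] EuclideanSpace ℝ (Fin n),
    E = T '' Metric.closedBall 0 1 ∧ T 0 = c

/-- The closed unit ball has the least volume among the ellipsoids `{x | ‖A x + b‖ ≤ 1}`
containing `S`, expressed through determinants. -/
def UnitBallMinimal {V : Type*} [NormedAddCommGroup V] [InnerProductSpace ℝ V]
    (S : Set V) : Prop :=
  ∀ (A : V →ₗ[ℝ] V) (b : V), (∀ x ∈ S, ‖A x + b‖ ≤ 1) → |LinearMap.det A| ≤ 1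

theorem LinearMap.det_eq_prod_of_apply_basis {V ι : Type*} [AddCommGroup V] [Module ℝ V]
    [Fintype ι] (e : Module.Basis ι ℝ V) {P : V →ₗ[ℝ] V} {s : ι → ℝ}
    (h : ∀ i, P (e i) = s i • e i) :
    LinearMap.det P = ∏ i, s i := by
  classical
  have : LinearMap.toMatrix e e P = Matrix.diagonal s := by
    ext i j
    rw [LinearMap.toMatrix_apply, h, map_smul, Module.Basis.repr_self, Matrix.diagonal_apply]
    by_cases hij : i = j
    · simp [hij]
    · simp [hij, Finsupp.single_eq_of_ne hij]
  rw [← LinearMap.det_toMatrix e, this, Matrix.det_diagonal]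

section InnerProductSpace

variable {V : Type*} [NormedAddCommGroup V] [InnerProductSpace ℝ V] [FiniteDimensional ℝ V]

theorem LinearIsometryEquiv.abs_det_eq_one (W : V ≃ₗᵢ[ℝ] V) :
    |LinearMap.det (W.toLinearEquiv : V →ₗ[ℝ] V)| = 1 := by
  rw [← LinearMap.normDet_eq_abs_det]
  exact W.toLinearIsometry.normDet_eq_one

/-- After composing with an isometry, an invertible operator becomes positive and diagonal in
some orthonormal basis. -/
theorem LinearMap.exists_isometry_comp_diagonal {A : V →ₗ[ℝ] V} (hA : LinearMap.det A ≠ 0) :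
    ∃ (W : V ≃ₗᵢ[ℝ] V) (e : OrthonormalBasis (Fin (Module.finrank ℝ V)) ℝ V)
      (s : Fin (Module.finrank ℝ V) → ℝ), (∀ i, 0 < s i) ∧ ∀ i, W (A (e i)) = s i • e i := by
  have hinj : Function.Injective A := (A.equivOfDetNeZero hA).injective
  have hM := LinearMap.isSymmetric_adjoint_mul_self A
  set e := hM.eigenvectorBasis rfl with he
  have hs : ∀ i, 0 < ‖A (e i)‖ := fun i =>
    norm_pos_iff.2 ((map_ne_zero_iff A hinj).2 (e.orthonormal.ne_zero i))
  have horth : Orthonormal ℝ fun i => ‖A (e i)‖⁻¹ • A (e i) := by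
    refine ⟨fun i => ?_, fun i j hij => ?_⟩
    · rw [norm_smul, norm_inv, norm_norm, inv_mul_cancel₀ (hs i).ne']
    · have : inner ℝ (A (e i)) (A (e j)) = 0 := by
        rw [← LinearMap.adjoint_inner_left]
        change inner ℝ ((LinearMap.adjoint A * A) (e i)) (e j) = 0
        rw [he, hM.apply_eigenvectorBasis, inner_smul_left, ← he, e.orthonormal.2 hij, mul_zero]
      simp only [inner_smul_left, inner_smul_right, this, mul_zero]
  let f : OrthonormalBasis (Fin (Module.finrank ℝ V)) ℝ V := OrthonormalBasis.mk horth
    (horth.linearIndependent.span_eq_top_of_card_eq_finrank' (by simp)).ge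
  refine ⟨f.equiv e (Equiv.refl _), e, fun i => ‖A (e i)‖, hs, fun i => ?_⟩
  have hf : A (e i) = ‖A (e i)‖ • f i := by
    simp [f, smul_smul, mul_inv_cancel₀ (hs i).ne']
  conv_lhs => rw [hf]
  simp

namespace UnitBallMinimal

variable {S : Set V}

theorem eq_zero_of_norm_add_le (hS : UnitBallMinimal S) (hV : 1 ≤ Module.finrank ℝ V)
    (h1 : ∀ x ∈ S, ‖x‖ ≤ 1) {b : V} (hb : ∀ x ∈ S, ‖x + b‖ ≤ 1) : b = 0 := by
  by_contra hb0
  have hbpos : 0 < ‖b‖ := norm_pos_iff.2 hb0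
  set k := Real.sqrt (1 + ‖b‖ ^ 2 / 4) with hk
  have hk2 : k ^ 2 = 1 + ‖b‖ ^ 2 / 4 := Real.sq_sqrt (by positivity)
  have hk0 : 0 ≤ k := Real.sqrt_nonneg _
  have hk1 : 1 < k := by
    by_contra! h
    nlinarith [pow_pos hbpos 2]
  have := hS (k • LinearMap.id) (k • (2⁻¹ : ℝ) • b) fun x hx => by
    have hpar := parallelogram_law_with_norm ℝ (x + b) x
    have hxb : x + b + x = (2 : ℝ) • (x + (2⁻¹ : ℝ) • b) := by module
    have hbb : x + b - x = b := by module
    rw [hxb, hbb, norm_smul, Real.norm_eq_abs, abs_two] at hpar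
    have e1 := h1 x hx
    have e2 := hb x hx
    have : ‖x + (2⁻¹ : ℝ) • b‖ ^ 2 ≤ 1 - ‖b‖ ^ 2 / 4 := by
      nlinarith [norm_nonneg x, norm_nonneg (x + b)]
    have : ‖k • (x + (2⁻¹ : ℝ) • b)‖ ^ 2 ≤ 1 := by
      rw [norm_smul, mul_pow, Real.norm_eq_abs, sq_abs, hk2]
      nlinarith [sq_nonneg (‖b‖ ^ 2 / 4), sq_nonneg ‖b‖]
    simpa [smul_add] using (sq_le_one_iff₀ (norm_nonneg _)).1 this
  rw [LinearMap.det_smul, LinearMap.det_id, mul_one, abs_of_nonneg (by positivity)] at this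
  exact absurd this (not_le.2 (one_lt_pow₀ hk1 (by omega)))

/-- Uniqueness of the minimal ellipsoid when the unit ball is minimal. -/
theorem norm_map_add (hS : UnitBallMinimal S) (hV : 1 ≤ Module.finrank ℝ V)
    (h1 : ∀ x ∈ S, ‖x‖ ≤ 1) {A : V →ₗ[ℝ] V} {b : V} (hA : |LinearMap.det A| = 1)
    (hb : ∀ x ∈ S, ‖A x + b‖ ≤ 1) (x : V) : ‖A x + b‖ = ‖x‖ := by
  obtain ⟨W, e, s, hs, hW⟩ := LinearMap.exists_isometry_comp_diagonal (A := A) (by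
    intro h
    simp [h] at hA)
  set P : V →ₗ[ℝ] V := (W.toLinearEquiv : V →ₗ[ℝ] V) ∘ₗ A with hP
  have hnorm : ∀ x, ‖A x + b‖ = ‖P x + W b‖ := fun x => by
    rw [← W.norm_map, map_add]
    rfl
  have hPe : ∀ i, P (e.toBasis i) = s i • e.toBasis i := by simpa [P] using hW
  have hdetP := LinearMap.det_eq_prod_of_apply_basis e.toBasis hPe
  have hprod : ∏ i, s i = 1 := by
    rw [← abs_of_pos (Finset.prod_pos fun i _ => hs i), ← hdetP, hP, LinearMap.det_comp, abs_mul,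
      W.abs_det_eq_one, hA, one_mul]
  set Q : V →ₗ[ℝ] V := (2⁻¹ : ℝ) • (LinearMap.id + P) with hQdef
  have hQe : ∀ i, Q (e.toBasis i) = ((1 + s i) / 2) • e.toBasis i := fun i => by
    rw [hQdef, LinearMap.smul_apply, LinearMap.add_apply, hPe, LinearMap.id_apply]
    module
  have hQ := hS Q ((2⁻¹ : ℝ) • W b) fun x hx => by
    have h2 := hb x hx
    rw [hnorm] at h2
    have : Q x + (2⁻¹ : ℝ) • W b = (2⁻¹ : ℝ) • (x + (P x + W b)) := by
      simp only [hQdef, LinearMap.smul_apply, LinearMap.add_apply, LinearMap.id_apply]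
      module
    rw [this, norm_smul, Real.norm_eq_abs, abs_of_pos (by norm_num)]
    linarith [norm_add_le x (P x + W b), h1 x hx]
  rw [LinearMap.det_eq_prod_of_apply_basis e.toBasis hQe,
    abs_of_nonneg (Finset.prod_nonneg fun i _ => by linarith [hs i])] at hQ
  have hs1 : ∀ i, s i = 1 := by
    by_contra! ⟨j, hj⟩
    have hlt : ∏ i, s i < ∏ i, ((1 + s i) / 2) ^ 2 :=
      Finset.prod_lt_prod (fun i _ => hs i) (fun i _ => by nlinarith [sq_nonneg (s i - 1)])
        ⟨j, Finset.mem_univ j, by nlinarith [sq_pos_of_ne_zero (sub_ne_zero.2 hj)]⟩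
    rw [hprod, Finset.prod_pow] at hlt
    have h0 : 0 ≤ ∏ i, ((1 + s i) / 2) :=
      Finset.prod_nonneg fun i _ => by linarith [hs i]
    nlinarith
  have hPid : P = LinearMap.id := e.toBasis.ext fun i => by
    rw [hPe, hs1, one_smul, LinearMap.id_apply]
  have hWb : W b = 0 := hS.eq_zero_of_norm_add_le hV h1 fun x hx => by
    have := hb x hx
    rwa [hnorm, hPid] at this
  rw [hnorm, hPid, hWb, add_zero, LinearMap.id_apply]

/-- If the unit ball is minimal for `S`, then no half-space whose boundary is at distance less
than the inverse of the dimension from the origin contains `S`. -/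
theorem one_le_finrank_mul_of_inner_le (hS : UnitBallMinimal S) (h1 : ∀ x ∈ S, ‖x‖ ≤ 1) {u : V}
    (hu : ‖u‖ = 1) {α : ℝ} (hα : 0 ≤ α) (hle : ∀ x ∈ S, inner ℝ u x ≤ α) :
    1 ≤ Module.finrank ℝ V * α := by
  by_contra! hlt
  set n := Module.finrank ℝ V with hn
  have hn1 : (1 : ℝ) ≤ n := by
    have : Nontrivial V := ⟨u, 0, fun h => by simp [h] at hu⟩
    exact_mod_cast Module.finrank_pos
  have hα1 : α < 1 := by nlinarith
  obtain ⟨β, hαβ, hβ⟩ : ∃ β, α < β ∧ n * β < 1 := by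
    obtain ⟨β, h, h'⟩ := exists_between ((lt_div_iff₀' (by linarith)).2 hlt)
    exact ⟨β, h, (lt_div_iff₀' (by linarith)).1 h'⟩
  obtain ⟨ε, hε, hε1, hε2⟩ : ∃ ε : ℝ, 0 < ε ∧ n * β * ε < 1 - n * β ∧ ε < 4 * (β - α) := by
    have hnβ : 0 < n * β := by nlinarith
    obtain ⟨ε, h, h'⟩ := exists_between
      (lt_min (div_pos (sub_pos.2 hβ) hnβ) (by linarith : 0 < 4 * (β - α)))
    exact ⟨ε, h, (lt_div_iff₀' hnβ).1 (h'.trans_le (min_le_left _ _)),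
      h'.trans_le (min_le_right _ _)⟩
  set R := 1 + ε * β with hR
  have hRpos : 0 < R := by nlinarith
  have hRn : R ^ n < 1 + ε := by
    have hx : n * β * ε < 1 := by nlinarith
    calc R ^ n ≤ Real.exp (ε * β) ^ n := by
          gcongr
          linarith [Real.add_one_le_exp (ε * β)]
      _ = Real.exp (n * β * ε) := by rw [← Real.exp_nat_mul]; ring_nf
      _ ≤ 1 / (1 - n * β * ε) :=
          Real.exp_bound_div_one_sub_of_interval
            (mul_nonneg (mul_nonneg n.cast_nonneg (hα.trans hαβ.le)) hε.le) hx
      _ < 1 + ε := by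
          rw [div_lt_iff₀ (by linarith)]
          nlinarith
  set k := (Real.sqrt R)⁻¹ with hk
  have hk2 : k ^ 2 * R = 1 := by
    rw [hk, inv_pow, Real.sq_sqrt hRpos.le, inv_mul_cancel₀ hRpos.ne']
  set s := Real.sqrt (1 + ε) with hs
  have hs2 : s ^ 2 = 1 + ε := Real.sq_sqrt (by linarith)
  set m := ε * (1 - α) / (2 * (1 + ε)) with hm
  have hmε : m * (2 * (1 + ε)) = ε * (1 - α) := div_mul_cancel₀ _ (by positivity)
  have hmε2 : (1 + ε) * m ^ 2 ≤ ε * (β - α) := by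
    have h0 : 0 ≤ m := div_nonneg (mul_nonneg hε.le (by linarith)) (by positivity)
    have h2 : m ≤ ε / 2 := by
      rw [hm, div_le_iff₀ (by positivity)]
      nlinarith [mul_nonneg hε.le hα, mul_pos hε hε]
    have h3 : (1 + ε) * m ≤ ε / 2 := by nlinarith [mul_nonneg hε.le hα]
    nlinarith [mul_le_mul h3 h2 h0 (by positivity)]
  have hdet := hS (k • LinearMap.transvection ((s - 1) • (innerₗ V u)) u) (k • (s * m) • u)
    fun x hx => by
      set t := inner ℝ u x with ht
      have hxt : (k • LinearMap.transvection ((s - 1) • (innerₗ V u)) u) x + k • (s * m) • u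
          = k • (x + ((s - 1) * t + s * m) • u) := by
        simp only [LinearMap.smul_apply, LinearMap.transvection.apply, innerₗ_apply_apply,
          smul_eq_mul, ← ht]
        module
      have hnx := h1 x hx
      have htα : t ≤ α := hle x hx
      have ht1 : -1 ≤ t := by
        have := neg_le_of_abs_le (abs_real_inner_le_norm u x)
        rw [hu, one_mul] at this
        linarith
      have hsq : ‖x + ((s - 1) * t + s * m) • u‖ ^ 2
          = ‖x‖ ^ 2 - t ^ 2 + s ^ 2 * (t + m) ^ 2 := by
        rw [norm_add_sq_real, inner_smul_right, real_inner_comm, ← ht, norm_smul, hu, mul_one,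
          Real.norm_eq_abs, sq_abs]
        ring
      have hleR : ‖x + ((s - 1) * t + s * m) • u‖ ^ 2 ≤ R := by
        have hq : s ^ 2 * (t + m) ^ 2
            = (1 + ε) * t ^ 2 + ε * (1 - α) * t + (1 + ε) * m ^ 2 := by
          rw [hs2, ← hmε]
          ring
        rw [hsq, hq]
        nlinarith [mul_nonneg hε.le (mul_nonneg (by linarith : 0 ≤ t + 1) (sub_nonneg.2 htα)),
          norm_nonneg x]
      rw [hxt, ← sq_le_one_iff₀ (norm_nonneg _), norm_smul, mul_pow, Real.norm_eq_abs, sq_abs]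
      calc k ^ 2 * _ ≤ k ^ 2 * R := by gcongr
        _ = 1 := hk2
  have hdet' : LinearMap.det (k • LinearMap.transvection ((s - 1) • (innerₗ V u)) u)
      = k ^ n * s := by
    rw [LinearMap.det_smul, LinearMap.transvection.det, LinearMap.smul_apply, innerₗ_apply_apply,
      real_inner_self_eq_norm_sq, hu, smul_eq_mul]
    ring
  rw [hdet', ← sq_le_one_iff_abs_le_one, mul_pow, hs2, ← pow_mul, mul_comm n 2, pow_mul] at hdet
  have hkn : (k ^ 2) ^ n * R ^ n = 1 := by rw [← mul_pow, hk2, one_pow]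
  have hkpos : 0 < (k ^ 2) ^ n := by
    have : 0 < k := inv_pos.2 (Real.sqrt_pos.2 hRpos)
    positivity
  nlinarith

theorem closedBall_subset_closure (hS : UnitBallMinimal S) (hV : 1 ≤ Module.finrank ℝ V)
    (hconv : Convex ℝ S) (hne : S.Nonempty) (h1 : ∀ x ∈ S, ‖x‖ ≤ 1) {y : V}
    (hy : ‖y‖ ≤ (Module.finrank ℝ V : ℝ)⁻¹) : y ∈ closure S := by
  by_contra hyS
  obtain ⟨f, c, hf, hc⟩ := geometric_hahn_banach_closed_point hconv.closure isClosed_closure hyS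
  have hfpos : 0 < ‖f‖ := by
    refine norm_pos_iff.2 fun h => ?_
    obtain ⟨x, hx⟩ := hne
    have := (hf x (subset_closure hx)).trans hc
    simp [h] at this
  have hn : (0 : ℝ) < Module.finrank ℝ V := by exact_mod_cast hV
  set u := ‖f‖⁻¹ • (InnerProductSpace.toDual ℝ V).symm f with hu
  have hfu : ∀ x, inner ℝ u x = f x / ‖f‖ := fun x => by
    rw [hu, real_inner_smul_left, InnerProductSpace.toDual_symm_apply, inv_mul_eq_div]
  have hun : ‖u‖ = 1 := by
    rw [hu, norm_smul, LinearIsometryEquiv.norm_map, norm_inv, norm_norm,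
      inv_mul_cancel₀ hfpos.ne']
  have h := hS.one_le_finrank_mul_of_inner_le h1 hun (le_max_right (c / ‖f‖) 0) fun x hx =>
    le_max_of_le_left (by rw [hfu]; gcongr; exact (hf x (subset_closure hx)).le)
  have hlt : max (c / ‖f‖) 0 < (Module.finrank ℝ V : ℝ)⁻¹ := by
    refine max_lt ?_ (inv_pos.2 hn)
    calc c / ‖f‖ < f y / ‖f‖ := by gcongr
      _ = inner ℝ u y := (hfu y).symm
      _ ≤ ‖u‖ * ‖y‖ := real_inner_le_norm u y
      _ ≤ _ := by rwa [hun, one_mul]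
  have := mul_lt_mul_of_pos_left hlt hn
  rw [mul_inv_cancel₀ hn.ne'] at this
  linarith

end UnitBallMinimal

end InnerProductSpace

section Ellipsoid

variable {n : ℕ}

local notation "𝔼" => EuclideanSpace ℝ (Fin n)

theorem AffineEquiv.apply_eq_linear_add {V : Type*} [AddCommGroup V] [Module ℝ V]
    (T : V ≃ᵃ[ℝ] V) (x : V) : T x = (T.linear : V →ₗ[ℝ] V) x + T 0 := by
  simpa using T.map_vadd 0 x

theorem AffineEquiv.exists_of_det_ne_zero {V : Type*} [AddCommGroup V] [Module ℝ V]
    [FiniteDimensional ℝ V] {A : V →ₗ[ℝ] V} (hA : LinearMap.det A ≠ 0) (b : V) :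
    ∃ S : V ≃ᵃ[ℝ] V, (∀ x, S x = A x + b) ∧ (S.linear : V →ₗ[ℝ] V) = A := by
  exact ⟨(A.equivOfDetNeZero hA).toAffineEquiv.trans (AffineEquiv.constVAdd ℝ V b),
    fun x => add_comm _ _, rfl⟩

theorem AffineEquiv.mem_image_closedBall_iff (T : 𝔼 ≃ᵃ[ℝ] 𝔼) (x : 𝔼) :
    x ∈ T '' Metric.closedBall 0 1 ↔ ‖T.symm x‖ ≤ 1 := by
  rw [← mem_closedBall_zero_iff]
  exact T.toEquiv.image_eq_preimage_symm _ ▸ Iff.rfl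

theorem AffineEquiv.volume_image (T : 𝔼 ≃ᵃ[ℝ] 𝔼) (s : Set 𝔼) :
    volume (T '' s) = ENNReal.ofReal |LinearMap.det (T.linear : 𝔼 →ₗ[ℝ] 𝔼)| * volume s := by
  rw [← Measure.addHaar_image_linearMap, ← measure_preimage_add_right volume (-T 0)
    ((T.linear : 𝔼 →ₗ[ℝ] 𝔼) '' s), ← Set.image_add_right, Set.image_image]
  exact congrArg volume (Set.image_congr fun x _ => T.apply_eq_linear_add x)

theorem AffineEquiv.volume_image_closedBall_le_iff (T T' : 𝔼 ≃ᵃ[ℝ] 𝔼) :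
    volume (T '' Metric.closedBall 0 1) ≤ volume (T' '' Metric.closedBall 0 1) ↔
      |LinearMap.det (T.linear : 𝔼 →ₗ[ℝ] 𝔼)| ≤ |LinearMap.det (T'.linear : 𝔼 →ₗ[ℝ] 𝔼)| := by
  have h0 : volume (Metric.closedBall (0 : 𝔼) 1) ≠ 0 :=
    (Metric.measure_closedBall_pos volume _ one_pos).ne'
  have htop : volume (Metric.closedBall (0 : 𝔼) 1) ≠ ⊤ := measure_closedBall_lt_top.ne
  rw [T.volume_image, T'.volume_image, ENNReal.mul_le_mul_iff_left h0 htop,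
    ENNReal.ofReal_le_ofReal_iff (abs_nonneg _)]

theorem AffineEquiv.abs_det_linear_pos (T : 𝔼 ≃ᵃ[ℝ] 𝔼) :
    0 < |LinearMap.det (T.linear : 𝔼 →ₗ[ℝ] 𝔼)| :=
  abs_pos.2 (LinearEquiv.isUnit_det' T.linear).ne_zero

theorem AffineEquiv.det_linear_mul_det_linear_symm (T : 𝔼 ≃ᵃ[ℝ] 𝔼) :
    |LinearMap.det (T.linear : 𝔼 →ₗ[ℝ] 𝔼)| * |LinearMap.det (T.symm.linear : 𝔼 →ₗ[ℝ] 𝔼)| = 1 := by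
  rw [← abs_mul, AffineEquiv.linear_symm, LinearEquiv.det_mul_det_symm, abs_one]

variable {Ω : Set (EuclideanSpace ℝ (Fin n))}

/-- The affine change of variables turning a minimal ellipsoid into the unit ball. -/
theorem UnitBallMinimal.of_volume_le {T : 𝔼 ≃ᵃ[ℝ] 𝔼}
    (hmin : ∀ (E' : Set 𝔼) (c' : 𝔼), IsEllipsoidWithCenter E' c' → Ω ⊆ E' →
      volume (T '' Metric.closedBall 0 1) ≤ volume E') : UnitBallMinimal (T ⁻¹' Ω) := by
  intro A b hAb
  rcases eq_or_ne (LinearMap.det A) 0 with h0 | h0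
  · simp [h0]
  obtain ⟨S, hS, hSA⟩ := AffineEquiv.exists_of_det_ne_zero h0 b
  have hle := hmin ((S.symm.trans T) '' Metric.closedBall 0 1) _ ⟨_, rfl, rfl⟩ fun x hx => by
    rw [AffineEquiv.mem_image_closedBall_iff]
    have := hAb (T.symm x) (by simpa using hx)
    rwa [← hS] at this
  rw [AffineEquiv.volume_image_closedBall_le_iff] at hle
  have hcomp : ((S.symm.trans T).linear : 𝔼 →ₗ[ℝ] 𝔼)
      = (T.linear : 𝔼 →ₗ[ℝ] 𝔼) ∘ₗ (S.symm.linear : 𝔼 →ₗ[ℝ] 𝔼) := rfl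
  rw [hcomp, LinearMap.det_comp, abs_mul] at hle
  have h1 : 1 ≤ |LinearMap.det (S.symm.linear : 𝔼 →ₗ[ℝ] 𝔼)| := by
    nlinarith [T.abs_det_linear_pos]
  have h2 := S.det_linear_mul_det_linear_symm
  rw [hSA] at h2
  nlinarith [abs_nonneg (LinearMap.det A)]

theorem norm_le_one_of_subset_image_closedBall {T : 𝔼 ≃ᵃ[ℝ] 𝔼}
    (hT : Ω ⊆ T '' Metric.closedBall 0 1) : ∀ x ∈ T ⁻¹' Ω, ‖x‖ ≤ 1 := fun x hx => by
  simpa using (T.mem_image_closedBall_iff _).1 (hT hx)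

/-- The affine maps sending a set with nonempty interior into the unit ball form a compact set. -/
theorem isCompact_setOf_mapsTo_closedBall {V : Type*} [NormedAddCommGroup V] [NormedSpace ℝ V]
    [FiniteDimensional ℝ V] {S : Set V} (hS : (interior S).Nonempty) :
    IsCompact {p : (V →L[ℝ] V) × V | ∀ x ∈ S, ‖p.1 x + p.2‖ ≤ 1} := by
  have := FiniteDimensional.proper ℝ ((V →L[ℝ] V) × V)
  refine Metric.isCompact_of_isClosed_isBounded ?_ ?_
  · simp only [Set.ofPred_forall]
    refine isClosed_biInter fun x _ => isClosed_le ?_ continuous_const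
    fun_prop
  · obtain ⟨x₀, hx₀⟩ := hS
    obtain ⟨r, hr, hball⟩ := Metric.nhds_basis_closedBall.mem_iff.1
      (mem_interior_iff_mem_nhds.1 hx₀)
    refine (Metric.isBounded_closedBall (x := (0 : (V →L[ℝ] V) × V))
      (r := max (2 / r) (1 + 2 / r * ‖x₀‖))).subset ?_
    rintro ⟨A, b⟩ h
    have hA : ‖A‖ ≤ 2 / r := by
      refine ContinuousLinearMap.opNorm_le_of_unit_norm (by positivity) fun x hx => ?_
      have h1 := h x₀ (hball (Metric.mem_closedBall_self hr.le))
      have h2 := h (x₀ + r • x) (hball (by simp [norm_smul, hx, abs_of_pos hr]))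
      have h3 : (A (x₀ + r • x) + b) - (A x₀ + b) = r • A x := by
        rw [map_add, map_smul]
        abel
      have h4 := norm_sub_le (A (x₀ + r • x) + b) (A x₀ + b)
      rw [h3, norm_smul, Real.norm_eq_abs, abs_of_pos hr] at h4
      rw [le_div_iff₀' hr]
      linarith
    have hb : ‖b‖ ≤ 1 + 2 / r * ‖x₀‖ := by
      have h1 := h x₀ (hball (Metric.mem_closedBall_self hr.le))
      have h2 := norm_sub_le (A x₀ + b) (A x₀)
      rw [add_sub_cancel_left] at h2
      have h3 := A.le_of_opNorm_le hA x₀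
      dsimp only at h1
      linarith
    rw [mem_closedBall_zero_iff, Prod.norm_def]
    exact max_le_max hA hb

theorem exists_minimal_ellipsoid (hne : (interior Ω).Nonempty) (hbdd : Bornology.IsBounded Ω) :
    ∃ T : 𝔼 ≃ᵃ[ℝ] 𝔼, Ω ⊆ T '' Metric.closedBall 0 1 ∧
      ∀ (E' : Set 𝔼) (c' : 𝔼), IsEllipsoidWithCenter E' c' → Ω ⊆ E' →
        volume (T '' Metric.closedBall 0 1) ≤ volume E' := by
  obtain ⟨r, hr, hΩr⟩ := hbdd.subset_closedBall_lt 0 (0 : 𝔼)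
  have hmem : ((r⁻¹ • ContinuousLinearMap.id ℝ 𝔼, 0) : (𝔼 →L[ℝ] 𝔼) × 𝔼) ∈
      {p : (𝔼 →L[ℝ] 𝔼) × 𝔼 | ∀ x ∈ Ω, ‖p.1 x + p.2‖ ≤ 1} := fun x hx => by
    have := mem_closedBall_zero_iff.1 (hΩr hx)
    simpa [norm_smul, abs_of_pos hr, inv_mul_le_iff₀ hr] using this
  obtain ⟨⟨A, b⟩, hAb, hmax⟩ := (isCompact_setOf_mapsTo_closedBall hne).exists_isMaxOn ⟨_, hmem⟩
    (f := fun p => |p.1.det|)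
    (ContinuousLinearMap.continuous_det.comp continuous_fst).abs.continuousOn
  have hA : LinearMap.det (A : 𝔼 →ₗ[ℝ] 𝔼) ≠ 0 := by
    have h1 : |(r⁻¹ • ContinuousLinearMap.id ℝ 𝔼).det| ≤ |A.det| := hmax hmem
    have h2 : (r⁻¹ • ContinuousLinearMap.id ℝ 𝔼).det = r⁻¹ ^ n := by
      rw [ContinuousLinearMap.det, ContinuousLinearMap.toLinearMap_smul, LinearMap.det_smul]
      simp
    rw [h2] at h1
    exact abs_pos.1 ((abs_pos.2 (by positivity)).trans_le h1)
  obtain ⟨S, hS, hSA⟩ := AffineEquiv.exists_of_det_ne_zero hA b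
  refine ⟨S.symm, fun x hx => ?_, ?_⟩
  · rw [AffineEquiv.mem_image_closedBall_iff]
    exact (hS x).symm ▸ hAb x hx
  · rintro _ c' ⟨T, rfl, -⟩ hT
    rw [AffineEquiv.volume_image_closedBall_le_iff]
    have h1 : |(LinearMap.toContinuousLinearMap (T.symm.linear : 𝔼 →ₗ[ℝ] 𝔼)).det| ≤ |A.det| :=
      hmax (a := (LinearMap.toContinuousLinearMap (T.symm.linear : 𝔼 →ₗ[ℝ] 𝔼), T.symm 0))
        fun x hx => by
          have := (T.mem_image_closedBall_iff x).1 (hT hx)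
          rwa [T.symm.apply_eq_linear_add] at this
    rw [LinearMap.det_toContinuousLinearMap, ContinuousLinearMap.det, ← hSA] at h1
    have h2 := T.det_linear_mul_det_linear_symm
    have h3 := S.det_linear_mul_det_linear_symm
    have h4 := T.abs_det_linear_pos
    have h5 := S.symm.abs_det_linear_pos
    by_contra! hlt
    have h6 := T.symm.abs_det_linear_pos
    nlinarith

/-- Two minimal ellipsoids coincide. -/
theorem image_closedBall_eq_of_volume_le (hn : 1 ≤ n) {T T' : 𝔼 ≃ᵃ[ℝ] 𝔼}
    (hT : Ω ⊆ T '' Metric.closedBall 0 1) (hT' : Ω ⊆ T' '' Metric.closedBall 0 1)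
    (hmin : ∀ (E' : Set 𝔼) (c' : 𝔼), IsEllipsoidWithCenter E' c' → Ω ⊆ E' →
      volume (T '' Metric.closedBall 0 1) ≤ volume E')
    (hle : volume (T' '' Metric.closedBall 0 1) ≤ volume (T '' Metric.closedBall 0 1)) :
    T' '' Metric.closedBall 0 1 = T '' Metric.closedBall 0 1 := by
  have hdet : |LinearMap.det (T.linear : 𝔼 →ₗ[ℝ] 𝔼)| = |LinearMap.det (T'.linear : 𝔼 →ₗ[ℝ] 𝔼)| :=
    le_antisymm ((T.volume_image_closedBall_le_iff T').1 (hmin _ _ ⟨T', rfl, rfl⟩ hT'))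
      ((T'.volume_image_closedBall_le_iff T).1 hle)
  have hcomp : ((T.trans T'.symm).linear : 𝔼 →ₗ[ℝ] 𝔼)
      = (T'.symm.linear : 𝔼 →ₗ[ℝ] 𝔼) ∘ₗ (T.linear : 𝔼 →ₗ[ℝ] 𝔼) := rfl
  have key := (UnitBallMinimal.of_volume_le hmin).norm_map_add (by simpa using hn)
    (norm_le_one_of_subset_image_closedBall hT)
    (A := ((T.trans T'.symm).linear : 𝔼 →ₗ[ℝ] 𝔼)) (b := (T.trans T'.symm) 0)
    (by rw [hcomp, LinearMap.det_comp, abs_mul, hdet, mul_comm,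
      T'.det_linear_mul_det_linear_symm])
    (fun x hx => by
      rw [← AffineEquiv.apply_eq_linear_add]
      exact (T'.mem_image_closedBall_iff _).1 (hT' hx))
  ext x
  have hx := key (T.symm x)
  rw [← AffineEquiv.apply_eq_linear_add, AffineEquiv.trans_apply, AffineEquiv.apply_symm_apply]
    at hx
  rw [AffineEquiv.mem_image_closedBall_iff, AffineEquiv.mem_image_closedBall_iff, hx]

end Ellipsoid

/-- Minimal (John) ellipsoid: a nonempty bounded convex open set `Ω ⊆ ℝ^n` admits a unique
ellipsoid of minimal volume among all ellipsoids containing it; moreover the dilation of this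
minimal ellipsoid by the factor `1/n` about its center is contained in the closure of `Ω`. -/
theorem minimal_ellipsoid {n : ℕ} (hn : 1 ≤ n) (Ω : Set (EuclideanSpace ℝ (Fin n)))
    (hne : Ω.Nonempty) (hbdd : Bornology.IsBounded Ω) (hconv : Convex ℝ Ω)
    (hopen : IsOpen Ω) :
    (∃! E : Set (EuclideanSpace ℝ (Fin n)),
      (∃ c, IsEllipsoidWithCenter E c) ∧ Ω ⊆ E ∧
        ∀ (E' : Set (EuclideanSpace ℝ (Fin n))) (c' : EuclideanSpace ℝ (Fin n)),
          IsEllipsoidWithCenter E' c' → Ω ⊆ E' → volume E ≤ volume E') ∧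
    ∀ (E : Set (EuclideanSpace ℝ (Fin n))) (c : EuclideanSpace ℝ (Fin n)),
      IsEllipsoidWithCenter E c → Ω ⊆ E →
      (∀ (E' : Set (EuclideanSpace ℝ (Fin n))) (c' : EuclideanSpace ℝ (Fin n)),
        IsEllipsoidWithCenter E' c' → Ω ⊆ E' → volume E ≤ volume E') →
      (fun y => c + ((n : ℝ))⁻¹ • (y - c)) '' E ⊆ closure Ω := by
  constructor
  · obtain ⟨T, hT, hmin⟩ := exists_minimal_ellipsoid (hopen.interior_eq.symm ▸ hne) hbdd
    refine ⟨T '' Metric.closedBall 0 1, ⟨⟨_, T, rfl, rfl⟩, hT, hmin⟩, ?_⟩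
    rintro _ ⟨⟨c', T', rfl, -⟩, hT', hmin'⟩
    exact image_closedBall_eq_of_volume_le hn hT hT' hmin (hmin' _ _ ⟨T, rfl, rfl⟩ hT)
  · rintro _ _ ⟨T, rfl, rfl⟩ hT hmin
    rintro _ ⟨_, ⟨x, hx, rfl⟩, rfl⟩
    have hz : T 0 + (n : ℝ)⁻¹ • (T x - T 0) = T ((n : ℝ)⁻¹ • x) := by
      rw [T.apply_eq_linear_add x, T.apply_eq_linear_add (_ • x), map_smul, add_sub_cancel_right,
        add_comm]
    have hcont : Continuous T := T.toAffineMap.continuous_of_finiteDimensional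
    have hmem : (n : ℝ)⁻¹ • x ∈ closure (T ⁻¹' Ω) := by
      refine (UnitBallMinimal.of_volume_le hmin).closedBall_subset_closure (by simpa using hn)
        (hconv.affine_preimage T.toAffineMap) (hne.preimage T.surjective)
        (norm_le_one_of_subset_image_closedBall hT) ?_
      rw [norm_smul, norm_inv, RCLike.norm_natCast, finrank_euclideanSpace_fin]
      exact mul_le_of_le_one_right (by positivity) (mem_closedBall_zero_iff.1 hx)
    change T 0 + (n : ℝ)⁻¹ • (T x - T 0) ∈ closure Ω
    rw [hz]
    exact closure_mono (Set.image_preimage_subset T Ω)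
      (image_closure_subset_closure_image hcont ⟨_, hmem, rfl⟩)
end

section
/- Let Ω be a nonempty bounded convex open subset of ℝ^n (n ≥ 1). Then there exist an affine map T : ℝ^n → ℝ^n whose linear part has determinant 1, a point c ∈ ℝ^n and a radius R > 0 such that the open ball B(c, R/n) is contained in T(Ω) and T(Ω) is contained in the closed ball B̄(c, R). -/
open Set

open Module Metric
open scoped RealInnerProductSpace

/-- A cut closer to the center than `1 / n` leaves room for a strict gain in the volume of the
enclosing ellipsoid. -/
lemma exists_pos_pow_lt_one_add {n : ℕ} {t : ℝ} (ht : 0 ≤ t) (hnt : n * t < 1) :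
    ∃ ε : ℝ, 0 < ε ∧ (1 + ε * (t + ε / 4)) ^ n < 1 + ε := by
  have hcont : ContinuousAt (fun ε : ℝ => n * (t + ε / 4) * (1 + ε)) 0 := by fun_prop
  have hev : ∀ᶠ ε in nhdsWithin (0 : ℝ) (Ioi 0), n * (t + ε / 4) * (1 + ε) < 1 :=
    nhdsWithin_le_nhds (hcont.eventually_lt continuousAt_const (by simpa using hnt))
  obtain ⟨ε, hε, hε0⟩ := (hev.and self_mem_nhdsWithin).exists
  have hε0 : 0 < ε := hε0
  refine ⟨ε, hε0, ?_⟩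
  set y := ε * (t + ε / 4) with hy
  have hy0 : 0 ≤ y := by positivity
  have hny : n * y * (1 + ε) < ε := by
    have := mul_lt_mul_of_pos_left hε hε0
    rw [hy]; linarith
  have hny1 : n * y < 1 := by
    by_contra! h
    nlinarith
  rcases Nat.eq_zero_or_pos n with rfl | hn
  · simpa using hε0
  have hy1 : y < 1 := by
    have : (1 : ℝ) ≤ n := by exact_mod_cast hn
    nlinarith
  have hbern : 1 - n * y ≤ (1 - y) ^ n := by
    simpa [sub_eq_add_neg] using one_add_mul_le_pow (a := -y) (by linarith) n
  have hprod : (1 + y) ^ n * (1 - y) ^ n ≤ 1 := by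
    rw [← mul_pow]
    exact pow_le_one₀ (mul_nonneg (by linarith) (by linarith)) (by nlinarith)
  have hpos : 0 < (1 + y) ^ n := by positivity
  have h1 : (1 + y) ^ n * (1 - n * y) ≤ 1 :=
    (mul_le_mul_of_nonneg_left hbern hpos.le).trans hprod
  by_contra! h
  nlinarith

section

variable {E : Type*} [NormedAddCommGroup E] [InnerProductSpace ℝ E]

lemma norm_add_smul_sq_of_norm_eq_one {u : E} (hu : ‖u‖ = 1) (x : E) (k : ℝ) :
    ‖x + k • u‖ ^ 2 = ‖x‖ ^ 2 + 2 * k * ⟪u, x⟫ + k ^ 2 := by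
  rw [norm_add_sq_real, inner_smul_right, real_inner_comm, norm_smul, hu, mul_one,
    Real.norm_eq_abs, sq_abs]
  ring

variable [FiniteDimensional ℝ E]

/-- A cap of the unit ball cut at height less than `1 / finrank ℝ E` is mapped into the unit ball
by an affine map which strictly increases volume. -/
lemma exists_one_lt_det_norm_le_of_cap {u : E} (hu : ‖u‖ = 1) {t : ℝ} (ht : 0 ≤ t) (ht1 : t ≤ 1)
    (hnt : finrank ℝ E * t < 1) :
    ∃ (M : E →L[ℝ] E) (v : E), 1 < M.det ∧
      ∀ x : E, ‖x‖ ≤ 1 → ⟪u, x⟫ ≤ t → ‖M x + v‖ ≤ 1 := by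
  obtain ⟨ε, hε, hlt⟩ := exists_pos_pow_lt_one_add ht hnt
  set ρ := 1 + ε * (t + ε / 4) with hρ
  have hρ0 : 0 < ρ := by positivity
  set α := (√ρ)⁻¹
  set γ := √(1 + ε)
  set s := ε * (1 - t) / (2 * (1 + ε)) with hs
  have hα : 0 < α := by positivity
  have hγ : 0 < γ := by positivity
  have hα2 : α ^ 2 = ρ⁻¹ := by rw [inv_pow, Real.sq_sqrt hρ0.le]
  have hγ2 : γ ^ 2 = 1 + ε := Real.sq_sqrt (by positivity)
  refine ⟨α • (ContinuousLinearMap.id ℝ E + (innerSL ℝ u).smulRight ((γ - 1) • u)),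
    (α * γ * s) • u, ?_, ?_⟩
  · have hdet : (α • (ContinuousLinearMap.id ℝ E + (innerSL ℝ u).smulRight ((γ - 1) • u))).det
        = α ^ finrank ℝ E * γ := by
      have : ((α • (ContinuousLinearMap.id ℝ E + (innerSL ℝ u).smulRight ((γ - 1) • u)) :
          E →L[ℝ] E) : E →ₗ[ℝ] E)
          = α • LinearMap.transvection (innerSL ℝ u : E →ₗ[ℝ] ℝ) ((γ - 1) • u) := by
        ext x
        simp [LinearMap.transvection.apply]
      rw [ContinuousLinearMap.det, this, LinearMap.det_smul, LinearMap.transvection.det]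
      simp [hu]
    rw [hdet]
    have hsq : 1 < (α ^ finrank ℝ E * γ) ^ 2 := by
      rw [mul_pow, hγ2, ← pow_mul, mul_comm (finrank ℝ E), pow_mul, hα2, inv_pow,
        inv_mul_eq_div, one_lt_div (by positivity)]
      exact hlt
    exact (one_lt_sq_iff₀ (by positivity)).1 hsq
  · intro x hx hxt
    set τ := ⟪u, x⟫ with hτ
    have hτ1 : -1 ≤ τ := by
      have h := abs_real_inner_le_norm u x
      rw [hu, one_mul] at h
      linarith [neg_abs_le ⟪u, x⟫]
    have heq : (α • (ContinuousLinearMap.id ℝ E + (innerSL ℝ u).smulRight ((γ - 1) • u))) x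
        + (α * γ * s) • u = α • (x + ((γ - 1) * τ + γ * s) • u) := by
      simp only [smul_apply, add_apply,
        ContinuousLinearMap.id_apply, ContinuousLinearMap.smulRight_apply, innerSL_apply_apply,
        ← hτ]
      module
    rw [heq, ← sq_le_one_iff₀ (norm_nonneg _), norm_smul, mul_pow, Real.norm_eq_abs, sq_abs, hα2,
      norm_add_smul_sq_of_norm_eq_one hu, ← hτ, inv_mul_le_one₀ hρ0]
    have hx2 : ‖x‖ ^ 2 ≤ 1 := pow_le_one₀ (norm_nonneg _) hx
    have hcap : ε * ((τ + 1) * (τ - t)) ≤ 0 :=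
      mul_nonpos_of_nonneg_of_nonpos hε.le
        (mul_nonpos_of_nonneg_of_nonpos (by linarith) (by linarith))
    have hs1 : 2 * (1 + ε) * s = ε * (1 - t) := by rw [hs]; field_simp
    have hs2 : (1 + ε) * s ^ 2 ≤ ε ^ 2 / 4 := by
      have h4 : (1 + ε) * ((1 + ε) * s ^ 2) = ε ^ 2 * (1 - t) ^ 2 / 4 := by
        linear_combination (2 * (1 + ε) * s + ε * (1 - t)) / 4 * hs1
      have h5 : (1 - t) ^ 2 ≤ 1 := pow_le_one₀ (by linarith) (by linarith)
      have h6 : 0 ≤ (1 + ε) * s ^ 2 := by positivity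
      nlinarith [mul_nonneg hε.le h6, mul_le_mul_of_nonneg_left h5 (sq_nonneg ε)]
    calc ‖x‖ ^ 2 + 2 * ((γ - 1) * τ + γ * s) * τ + ((γ - 1) * τ + γ * s) ^ 2
        = ‖x‖ ^ 2 + ε * ((τ + 1) * (τ - t)) + ε * t + (1 + ε) * s ^ 2 := by
          linear_combination (τ + s) ^ 2 * hγ2 + τ * hs1
      _ ≤ ρ := by rw [hρ]; linarith

/-- If the closed unit ball is a minimal-volume ellipsoid around an open convex set, then the
concentric ball of radius `1 / finrank ℝ E` is contained in that set. -/
lemma ball_subset_of_forall_det_le_one {K : Set E} (hne : K.Nonempty) (hconv : Convex ℝ K)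
    (hopen : IsOpen K) (hK : ∀ x ∈ K, ‖x‖ ≤ 1)
    (hmax : ∀ (M : E →L[ℝ] E) (v : E), (∀ x ∈ K, ‖M x + v‖ ≤ 1) → M.det ≤ 1) :
    ball 0 (1 / (finrank ℝ E : ℝ)) ⊆ K := by
  intro p hp
  by_contra hpK
  obtain ⟨f, hf⟩ := geometric_hahn_banach_open_point hconv hopen hpK
  set w := (InnerProductSpace.toDual ℝ E).symm f
  have hw : ∀ x, ⟪w, x⟫ = f x := fun x => InnerProductSpace.toDual_symm_apply
  have hw0 : w ≠ 0 := by
    intro h0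
    obtain ⟨a, ha⟩ := hne
    have h := hf a ha
    rw [← hw, ← hw, h0, inner_zero_left, inner_zero_left] at h
    exact lt_irrefl _ h
  have hwpos : 0 < ‖w‖ := norm_pos_iff.2 hw0
  have hp' : ‖p‖ < 1 / (finrank ℝ E : ℝ) := mem_ball_zero_iff.1 hp
  have : Nontrivial E := nontrivial_of_ne w 0 hw0
  have hn : (1 : ℝ) ≤ finrank ℝ E := by exact_mod_cast finrank_pos (R := ℝ) (M := E)
  have hnp : finrank ℝ E * ‖p‖ < 1 := by
    rwa [lt_div_iff₀ (by linarith), mul_comm] at hp'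
  have hu : ‖‖w‖⁻¹ • w‖ = 1 := norm_smul_inv_norm hw0
  obtain ⟨M, v, hM, hMv⟩ := exists_one_lt_det_norm_le_of_cap hu (norm_nonneg p)
    (by nlinarith [norm_nonneg p]) hnp
  refine hM.not_ge (hmax M v fun x hx => hMv x (hK x hx) ?_)
  calc ⟪‖w‖⁻¹ • w, x⟫ ≤ ⟪‖w‖⁻¹ • w, p⟫ := by
        rw [real_inner_smul_left, real_inner_smul_left, hw, hw]
        exact mul_le_mul_of_nonneg_left (hf x hx).le (by positivity)
    _ ≤ ‖p‖ := by simpa [hu] using real_inner_le_norm (‖w‖⁻¹ • w) p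

/-- The affine maps sending a set with nonempty interior into the closed unit ball form a compact
set. -/
lemma isCompact_setOf_affine_norm_le_one {Ω : Set E} (hint : (interior Ω).Nonempty) :
    IsCompact {q : (E →L[ℝ] E) × E | ∀ x ∈ Ω, ‖q.1 x + q.2‖ ≤ 1} := by
  obtain ⟨x₀, hx₀⟩ := hint
  obtain ⟨r, hr, hball⟩ := isOpen_iff.1 isOpen_interior x₀ hx₀
  replace hball := hball.trans interior_subset
  refine isCompact_of_isClosed_isBounded ?_ ?_
  · simp only [ofPred_forall]
    refine isClosed_biInter fun x _ => isClosed_le ?_ continuous_const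
    fun_prop
  · refine isBounded_iff_forall_norm_le.2 ⟨max (4 / r) (1 + 4 / r * ‖x₀‖), ?_⟩
    rintro ⟨A, b⟩ hq
    have hx₀' : ‖A x₀ + b‖ ≤ 1 := hq x₀ (hball (mem_ball_self hr))
    have hA : ‖A‖ ≤ 4 / r := by
      refine A.opNorm_le_of_shell hr (by positivity) (c := (2 : ℝ)) (by norm_num) fun x hx hxr => ?_
      have hx' : ‖A (x₀ + x) + b‖ ≤ 1 := hq _ (hball (by simpa using hxr))
      rw [Real.norm_ofNat] at hx
      calc ‖A x‖ = ‖(A (x₀ + x) + b) - (A x₀ + b)‖ := by rw [map_add]; congr 1; abel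
        _ ≤ 1 + 1 := (norm_sub_le _ _).trans (add_le_add hx' hx₀')
        _ = 4 / r * (r / 2) := by field_simp; norm_num
        _ ≤ 4 / r * ‖x‖ := by gcongr
    have hb : ‖b‖ ≤ 1 + 4 / r * ‖x₀‖ :=
      calc ‖b‖ = ‖(A x₀ + b) - A x₀‖ := by rw [add_sub_cancel_left]
        _ ≤ 1 + 4 / r * ‖x₀‖ := (norm_sub_le _ _).trans (add_le_add hx₀' (A.le_of_opNorm_le hA x₀))
    exact max_le_max hA hb

/-- John's theorem for a bounded open convex set, with the minimal-volume ellipsoid normalized to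
be the unit ball. -/
lemma exists_det_pos_ball_subset_image_subset_closedBall {Ω : Set E} (hne : Ω.Nonempty)
    (hbdd : Bornology.IsBounded Ω) (hconv : Convex ℝ Ω) (hopen : IsOpen Ω) :
    ∃ (A : E →L[ℝ] E) (b : E), 0 < A.det ∧
      ball 0 (1 / (finrank ℝ E : ℝ)) ⊆ (fun x => A x + b) '' Ω ∧
      (fun x => A x + b) '' Ω ⊆ closedBall 0 1 := by
  have hcomp := isCompact_setOf_affine_norm_le_one (hopen.interior_eq.symm ▸ hne)
  obtain ⟨C, hC0, hC⟩ := hbdd.exists_pos_norm_le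
  have hmem : (C⁻¹ • ContinuousLinearMap.id ℝ E, (0 : E)) ∈
      {q : (E →L[ℝ] E) × E | ∀ x ∈ Ω, ‖q.1 x + q.2‖ ≤ 1} := by
    intro x hx
    simpa [norm_smul, abs_of_pos hC0, inv_mul_le_one₀ hC0] using hC x hx
  obtain ⟨⟨A, b⟩, hAb, hmax⟩ := hcomp.exists_isMaxOn ⟨_, hmem⟩
    (f := fun q : (E →L[ℝ] E) × E => q.1.det)
    (ContinuousLinearMap.continuous_det.comp continuous_fst).continuousOn
  have hdet : 0 < A.det := by
    refine lt_of_lt_of_le ?_ (hmax hmem)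
    simp only [ContinuousLinearMap.det, ContinuousLinearMap.toLinearMap_smul,
      ContinuousLinearMap.coe_id, LinearMap.det_smul, LinearMap.det_id]
    positivity
  refine ⟨A, b, hdet, ?_, ?_⟩
  · have hsurj : Function.Surjective A :=
      (LinearMap.equivOfDetNeZero (A : E →ₗ[ℝ] E) hdet.ne').surjective
    refine ball_subset_of_forall_det_le_one (hne.image _) ?_ ?_ ?_ ?_
    · have h := (hconv.linear_image (A : E →ₗ[ℝ] E)).translate b
      rw [image_image] at h
      simpa [add_comm] using h
    · exact ((Homeomorph.addRight b).isOpenMap.comp (A.isOpenMap hsurj)) _ hopen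
    · rintro _ ⟨x, hx, rfl⟩
      exact hAb x hx
    · intro M v hM
      have hle : (M.comp A).det ≤ A.det := by
        refine hmax (a := (M.comp A, M b + v)) fun x hx => ?_
        have h := hM _ (mem_image_of_mem _ hx)
        simpa [map_add, add_assoc] using h
      have hmul : (M.comp A).det = M.det * A.det := LinearMap.det_comp _ _
      rw [hmul] at hle
      exact le_of_mul_le_mul_right (by simpa using hle) hdet
  · rintro _ ⟨x, hx, rfl⟩
    exact mem_closedBall_zero_iff.2 (hAb x hx)

end

/-- Normalization of a bounded convex open domain `Ω ⊆ ℝ^n`: there is an affine map whose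
linear part has determinant `1` sending `Ω` between a ball of radius `R/n` and the
concentric closed ball of radius `R`. -/
theorem john_normalization {n : ℕ} (hn : 1 ≤ n) (Ω : Set (EuclideanSpace ℝ (Fin n)))
    (hne : Ω.Nonempty) (hbdd : Bornology.IsBounded Ω) (hconv : Convex ℝ Ω)
    (hopen : IsOpen Ω) :
    ∃ (A : EuclideanSpace ℝ (Fin n) →ₗ[ℝ] EuclideanSpace ℝ (Fin n))
      (b c : EuclideanSpace ℝ (Fin n)) (R : ℝ),
      LinearMap.det A = 1 ∧ 0 < R ∧
      Metric.ball c (R / n) ⊆ (fun x => A x + b) '' Ω ∧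
      (fun x => A x + b) '' Ω ⊆ Metric.closedBall c R := by
  obtain ⟨A, b, hdet, hsub, hsup⟩ :=
    exists_det_pos_ball_subset_image_subset_closedBall hne hbdd hconv hopen
  rw [finrank_euclideanSpace_fin] at hsub
  obtain ⟨R, hR, hRn⟩ : ∃ R : ℝ, 0 < R ∧ R ^ n = A.det⁻¹ :=
    ⟨A.det⁻¹ ^ ((n : ℝ)⁻¹), Real.rpow_pos_of_pos (inv_pos.2 hdet) _,
      Real.rpow_inv_natCast_pow (inv_pos.2 hdet).le (by omega)⟩
  have himage : (fun x => (R • (A : EuclideanSpace ℝ (Fin n) →ₗ[ℝ] EuclideanSpace ℝ (Fin n))) x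
      + R • b) '' Ω = (fun y => R • y) '' ((fun x => A x + b) '' Ω) := by
    rw [image_image]
    simp [smul_add]
  refine ⟨R • (A : EuclideanSpace ℝ (Fin n) →ₗ[ℝ] EuclideanSpace ℝ (Fin n)), R • b, 0, R, ?_, hR,
    ?_, ?_⟩
  · rw [LinearMap.det_smul, finrank_euclideanSpace_fin, hRn]
    exact inv_mul_cancel₀ hdet.ne'
  · rw [himage]
    intro y hy
    refine ⟨R⁻¹ • y, hsub ?_, smul_inv_smul₀ hR.ne' y⟩
    rw [mem_ball_zero_iff] at hy ⊢
    rw [norm_smul, norm_inv, Real.norm_of_nonneg hR.le, inv_mul_lt_iff₀ hR, mul_one_div]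
    exact hy
  · rw [himage]
    rintro _ ⟨y, hy, rfl⟩
    have hy1 : ‖y‖ ≤ 1 := mem_closedBall_zero_iff.1 (hsup hy)
    rw [mem_closedBall_zero_iff, norm_smul, Real.norm_of_nonneg hR.le]
    exact mul_le_of_le_one_right hR.le hy1
end
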